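/- The number of solutions (v, (a,b), z) equals the binomial coefficient C(p2+q2, p2). -/

import Mathlib

/-- A block vector with `r` head entries `f m + (m+1)`, then `c` equal middle entries
`mid`, then tail entries `g (m − (r+c)) + (m+1)` (0-based index `m`).  With
`f = i, g = j` (resp. `f = k, g = l`) and `mid = (p2+q2+1)/2 + r` (resp. `+ t`) this is
the left (resp. right) block of the vector `τ̃` of the `U(p,q)` computation. -/
def blockVec (r c : ℕ) (mid : ℚ) (f g : ℕ → ℚ) : ℕ → ℚ := fun m =>
  if m < r then f m + (m + 1)
  else if m < r + c then mid
  else g (m - (r + c)) + (m + 1)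

/-- The left block of the vector `μ̃(a,b)` of the `U(p,q)` computation
(0-based index `m`, relevant for `m < p = p1 + p2 = p2 + r + s + q2`). -/
def muLeft (p1 q1 p2 q2 r s : ℕ) (ξ : ℤ) (b : Fin p2 → ℤ) (a : Fin q2 → ℤ) :
    ℕ → ℚ := fun m =>
  if h : m < p2 then ((p1 : ℚ) - q1) / 2 - b ⟨m, h⟩ + (m + 1)
  else if m < p2 + r + s then (ξ : ℚ) + ((q2 : ℚ) - p2) / 2 + (m + 1)
  else if h3 : p2 + r + s + q2 - 1 - m < q2 then
    (ξ : ℚ) + ((q2 : ℚ) - p2) / 2 + a ⟨p2 + r + s + q2 - 1 - m, h3⟩ + (m + 1)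
  else 0

/-- The right block of the vector `μ̃(a,b)` of the `U(p,q)` computation
(0-based index `m`, relevant for `m < q = q1 + q2 = q2 + t + u + p2`). -/
def muRight (p1 q1 p2 q2 t u : ℕ) (ξ : ℤ) (b : Fin p2 → ℤ) (a : Fin q2 → ℤ) :
    ℕ → ℚ := fun m =>
  if h : m < q2 then ((q1 : ℚ) - p1) / 2 - a ⟨m, h⟩ + (m + 1)
  else if m < q2 + t + u then (ξ : ℚ) + ((p2 : ℚ) - q2) / 2 + (m + 1)
  else if h3 : q2 + t + u + p2 - 1 - m < p2 then
    (ξ : ℚ) + ((p2 : ℚ) - q2) / 2 + b ⟨q2 + t + u + p2 - 1 - m, h3⟩ + (m + 1)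
  else 0

/-- A *solution* `(v, (a,b), z)` of the Dirac cohomology equation for the unipotent
representation `X(p1,q1,ξ)` of `U(p,q)`: the left (length `p = p1+p2`) and right
(length `q = q1+q2`) blocks of `v` are permutations of the corresponding blocks of
`τ̃`; `b_1 ≥ … ≥ b_{p2} ≥ 0` and `a_1 ≥ … ≥ a_{q2} ≥ 0` are integers; `z` is a shuffle
vector (both blocks strictly decreasing, with multiset of all `p+q` coordinates equal
to `{(p+q−1)/2, (p+q−3)/2, …, −(p+q−1)/2}`); and `v = μ̃(a,b) + z` coordinatewise. -/
structure USol (p1 p2 q1 q2 r s t u : ℕ) (ξ : ℤ) (i j k l : ℕ → ℚ) where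
  vL : Fin (p1 + p2) → ℚ
  vR : Fin (q1 + q2) → ℚ
  b : Fin p2 → ℤ
  a : Fin q2 → ℤ
  zL : Fin (p1 + p2) → ℚ
  zR : Fin (q1 + q2) → ℚ
  b_anti : Antitone b
  b_nonneg : ∀ m, 0 ≤ b m
  a_anti : Antitone a
  a_nonneg : ∀ m, 0 ≤ a m
  hvL : Multiset.map vL Finset.univ.val =
    Multiset.map (fun m : Fin (p1 + p2) =>
      blockVec r (p2 + q2) (((p2 : ℚ) + q2 + 1) / 2 + r) i j m.1) Finset.univ.val
  hvR : Multiset.map vR Finset.univ.val =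
    Multiset.map (fun m : Fin (q1 + q2) =>
      blockVec t (p2 + q2) (((p2 : ℚ) + q2 + 1) / 2 + t) k l m.1) Finset.univ.val
  zL_anti : StrictAnti zL
  zR_anti : StrictAnti zR
  hz : Multiset.map zL Finset.univ.val + Multiset.map zR Finset.univ.val =
    Multiset.map (fun m : ℕ => ((p1 : ℚ) + p2 + q1 + q2 - 1) / 2 - m)
      (Finset.range (p1 + p2 + q1 + q2)).val
  heqL : ∀ m : Fin (p1 + p2), vL m = muLeft p1 q1 p2 q2 r s ξ b a m.1 + zL m
  heqR : ∀ m : Fin (q1 + q2), vR m = muRight p1 q1 p2 q2 t u ξ b a m.1 + zR m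

/-- Conjugate lattice-path data. -/
def Cj (p q : ℕ) (β α : ℕ → ℕ) : Prop :=
  (∀ m < p, ∀ θ < q, (β m ≤ θ ↔ m < α θ)) ∧ (∀ m < p, β m ≤ q) ∧ (∀ θ < q, α θ ≤ p)

theorem Cj.symm {p q : ℕ} {β α : ℕ → ℕ} (h : Cj p q β α) : Cj q p α β := by
  obtain ⟨h1, h2, h3⟩ := h
  refine ⟨fun m hm θ hθ => ?_, h3, h2⟩
  have := h1 θ hθ m hm
  omega

theorem Cj.mono {p q : ℕ} {β α : ℕ → ℕ} (h : Cj p q β α) {m m' : ℕ} (hm : m ≤ m') (hp : m' < p) :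
    β m ≤ β m' := by
  obtain ⟨h1, h2, h3⟩ := h
  have a1 := h2 m' hp
  have a2 := h2 m (by omega)
  by_cases hq : β m' < q
  · have b1 := h1 m' hp (β m') hq
    have b2 := h1 m (by omega) (β m') hq
    omega
  · omega

theorem Cj.count_le {p q : ℕ} {β α : ℕ → ℕ} (h : Cj p q β α) {θ : ℕ} (hθ : θ < q) :
    ((Finset.range p).filter (fun m => β m ≤ θ)).card = α θ := by
  obtain ⟨h1, h2, h3⟩ := h
  have : (Finset.range p).filter (fun m => β m ≤ θ) = Finset.range (α θ) := by
    ext m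
    have := h3 θ hθ
    simp only [Finset.mem_filter, Finset.mem_range]
    constructor
    · rintro ⟨a, b⟩; exact (h1 m a θ hθ).1 b
    · intro a; exact ⟨by omega, (h1 m (by omega) θ hθ).2 a⟩
  rw [this, Finset.card_range]

theorem Cj.count_gt {p q : ℕ} {β α : ℕ → ℕ} (h : Cj p q β α) {θ : ℕ} (hθ : θ < q) :
    ((Finset.range p).filter (fun m => θ < β m)).card + α θ = p := by
  rw [← h.count_le hθ]
  have := Finset.card_filter_add_card_filter_not (s := Finset.range p) (fun m => β m ≤ θ)
  simp only [not_le, Finset.card_range] at this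
  omega

theorem Cj.unique {p q : ℕ} {β β' α α' : ℕ → ℕ} (h : Cj p q β α) (h' : Cj p q β' α')
    (he : ∀ m < p, β m = β' m) : ∀ θ < q, α θ = α' θ := by
  intro θ hθ
  rw [← h.count_le hθ, ← h'.count_le hθ]
  congr 1
  apply Finset.filter_congr
  intro m hm
  rw [he m (by simpa using hm)]

/-- Concatenation. -/
def ccat (p q : ℕ) (β β' : ℕ → ℕ) : ℕ → ℕ := fun m => if m < p then β m else q + β' (m - p)

theorem Cj.ccat {p q p' q' : ℕ} {β β' α α' : ℕ → ℕ} (h : Cj p q β α) (h' : Cj p' q' β' α') :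
    Cj (p + p') (q + q') (ccat p q β β') (ccat q p α α') := by
  obtain ⟨h1, h2, h3⟩ := h
  obtain ⟨g1, g2, g3⟩ := h'
  refine ⟨fun m hm θ hθ => ?_, fun m hm => ?_, fun m hm => ?_⟩
  · unfold _root_.ccat
    split_ifs with c1 c2 c2
    · exact h1 m c1 θ c2
    · have := h2 m c1
      omega
    · have := h3 θ c2
      omega
    · have := g1 (m - p) (by omega) (θ - q) (by omega)
      omega
  · unfold _root_.ccat
    split_ifs with c1
    · have := h2 m c1; omega
    · have := g2 (m - p) (by omega); omega
  · unfold _root_.ccat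
    split_ifs with c1
    · have := h3 m c1; omega
    · have := g3 (m - q) (by omega); omega

theorem range_map_add {X : Type*} (f : ℕ → X) (a b : ℕ) :
    (Multiset.range (a + b)).map f = (Multiset.range a).map f +
      (Multiset.range b).map (fun m => f (a + m)) := by
  rw [Multiset.range_add, Multiset.map_add, Multiset.map_map]
  rfl

theorem fin_map_range {X : Type*} (f : ℕ → X) (n : ℕ) :
    Multiset.map (fun m : Fin n => f m.1) Finset.univ.val = (Multiset.range n).map f := by
  have : Multiset.map (fun m : Fin n => m.1) Finset.univ.val = Multiset.range n := by
    have := congrArg Finset.val (Fin.map_valEmbedding_univ (n := n))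
    rw [Finset.map_val] at this
    rw [Nat.Iio_eq_range] at this
    exact this
  rw [← this, Multiset.map_map]
  rfl

/-- Shuffles from conjugate data. -/
theorem shuffle_of_cj {p q : ℕ} {β α : ℕ → ℕ} (h : Cj p q β α) :
    (Multiset.range p).map (fun m => m + β m) + (Multiset.range q).map (fun m => m + α m) =
      Multiset.range (p + q) := by
  have hm : ∀ {m m' : ℕ}, m < m' → m' < p → β m ≤ β m' := fun a b => h.mono a.le b
  have hm' : ∀ {m m' : ℕ}, m < m' → m' < q → α m ≤ α m' := fun a b => h.symm.mono a.le b
  obtain ⟨h1, h2, h3⟩ := h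
  apply Multiset.eq_of_le_of_card_le
  · rw [Multiset.le_iff_subset]
    · intro x hx
      simp only [Multiset.mem_add, Multiset.mem_map, Multiset.mem_range] at hx ⊢
      rcases hx with ⟨m, a, rfl⟩ | ⟨m, a, rfl⟩
      · have := h2 m a; omega
      · have := h3 m a; omega
    · rw [Multiset.nodup_add]
      refine ⟨?_, ?_, ?_⟩
      · apply Multiset.Nodup.map_on _ (Multiset.nodup_range p)
        intro x hx y hy e
        simp only [Multiset.mem_range] at hx hy
        rcases lt_trichotomy x y with c | c | c
        · have := hm c hy; omega
        · exact c
        · have := hm c hx; omega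
      · apply Multiset.Nodup.map_on _ (Multiset.nodup_range q)
        intro x hx y hy e
        simp only [Multiset.mem_range] at hx hy
        rcases lt_trichotomy x y with c | c | c
        · have := hm' c hy; omega
        · exact c
        · have := hm' c hx; omega
      · rw [Multiset.disjoint_left]
        intro x hx hy
        simp only [Multiset.mem_map, Multiset.mem_range] at hx hy
        obtain ⟨m, a, rfl⟩ := hx
        obtain ⟨θ, b, e⟩ := hy
        have := h1 m a θ b
        omega
  · simp

/-- Conjugate data from integer shuffles. -/
theorem cj_of_nat {p q : ℕ} {x y : ℕ → ℕ}
    (hx : ∀ m m', m < m' → m' < p → x m < x m') (hy : ∀ m m', m < m' → m' < q → y m < y m')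
    (hxy : ∀ m < p, ∀ θ < q, x m ≠ y θ) (hxb : ∀ m < p, x m < p + q) (hyb : ∀ θ < q, y θ < p + q) :
    ∃ β α, Cj p q β α ∧ (∀ m < p, x m = m + β m) ∧ (∀ θ < q, y θ = θ + α θ) := by
  have hxi : ∀ m < p, ∀ m' < p, (x m' < x m ↔ m' < m) := by
    intro m a m' b
    constructor
    · intro c
      by_contra d
      rcases eq_or_lt_of_le (not_lt.1 d) with e | e
      · subst e; omega
      · have := hx _ _ e b; omega
    · intro c; exact hx _ _ c a
  have hyi : ∀ m < q, ∀ m' < q, (y m' < y m ↔ m' < m) := by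
    intro m a m' b
    constructor
    · intro c
      by_contra d
      rcases eq_or_lt_of_le (not_lt.1 d) with e | e
      · subst e; omega
      · have := hy _ _ e b; omega
    · intro c; exact hy _ _ c a
  have injx : Set.InjOn x (Finset.range p) := by
    intro m a m' b e
    simp only [Finset.coe_range, Set.mem_Iio] at a b
    have := hxi m a m' b
    have := hxi m' b m a
    omega
  have injy : Set.InjOn y (Finset.range q) := by
    intro m a m' b e
    simp only [Finset.coe_range, Set.mem_Iio] at a b
    have := hyi m a m' b
    have := hyi m' b m a
    omega
  have hdis : Disjoint ((Finset.range p).image x) ((Finset.range q).image y) := by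
    rw [Finset.disjoint_left]
    intro z a b
    simp only [Finset.mem_image, Finset.mem_range] at a b
    obtain ⟨m, a, rfl⟩ := a
    obtain ⟨θ, b, e⟩ := b
    exact hxy m a θ b e.symm
  have hun : (Finset.range p).image x ∪ (Finset.range q).image y = Finset.range (p + q) := by
    apply Finset.eq_of_subset_of_card_le
    · intro z a
      simp only [Finset.mem_union, Finset.mem_image, Finset.mem_range] at a ⊢
      rcases a with ⟨m, a, rfl⟩ | ⟨m, a, rfl⟩
      · exact hxb m a
      · exact hyb m a
    · rw [Finset.card_union_of_disjoint hdis, Finset.card_image_of_injOn injx,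
        Finset.card_image_of_injOn injy]
      simp
  have hcount : ∀ w ≤ p + q, w = ((Finset.range p).filter (fun m => x m < w)).card +
      ((Finset.range q).filter (fun m => y m < w)).card := by
    intro w hw
    have e : Finset.range w = ((Finset.range p).filter (fun m => x m < w)).image x ∪
      ((Finset.range q).filter (fun m => y m < w)).image y := by
      ext z
      have := Finset.ext_iff.1 hun z
      simp only [Finset.mem_union, Finset.mem_image, Finset.mem_range, Finset.mem_filter] at this ⊢
      constructor
      · intro hz
        rcases this.2 (by omega) with ⟨m, a, rfl⟩ | ⟨m, a, rfl⟩
        · exact Or.inl ⟨m, ⟨a, hz⟩, rfl⟩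
        · exact Or.inr ⟨m, ⟨a, hz⟩, rfl⟩
      · rintro (⟨m, ⟨a, b⟩, rfl⟩ | ⟨m, ⟨a, b⟩, rfl⟩) <;> exact b
    have e2 := congrArg Finset.card e
    rw [Finset.card_range, Finset.card_union_of_disjoint, Finset.card_image_of_injOn,
      Finset.card_image_of_injOn] at e2
    · exact e2
    · exact injy.mono (by intro z; simp; tauto)
    · exact injx.mono (by intro z; simp; tauto)
    · exact Finset.disjoint_of_subset_left (Finset.image_subset_image (Finset.filter_subset _ _))
        (Finset.disjoint_of_subset_right (Finset.image_subset_image (Finset.filter_subset _ _)) hdis)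
  have cx : ∀ m < p, ((Finset.range p).filter (fun m' => x m' < x m)).card = m := by
    intro m a
    have : (Finset.range p).filter (fun m' => x m' < x m) = Finset.range m := by
      ext z
      simp only [Finset.mem_filter, Finset.mem_range]
      constructor
      · rintro ⟨b, c⟩; exact (hxi m a z b).1 c
      · intro b; exact ⟨by omega, hx _ _ b a⟩
    rw [this, Finset.card_range]
  have cy : ∀ m < q, ((Finset.range q).filter (fun m' => y m' < y m)).card = m := by
    intro m a
    have : (Finset.range q).filter (fun m' => y m' < y m) = Finset.range m := by
      ext z
      simp only [Finset.mem_filter, Finset.mem_range]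
      constructor
      · rintro ⟨b, c⟩; exact (hyi m a z b).1 c
      · intro b; exact ⟨by omega, hy _ _ b a⟩
    rw [this, Finset.card_range]
  refine ⟨fun m => ((Finset.range q).filter (fun θ => y θ < x m)).card,
    fun θ => ((Finset.range p).filter (fun m => x m < y θ)).card, ⟨?_, ?_, ?_⟩, ?_, ?_⟩
  · intro m hm θ hθ
    have key : ∀ m < p, ∀ θ < q,
        (((Finset.range q).filter (fun θ => y θ < x m)).card ≤ θ ↔ x m < y θ) := by
      intro m hm θ hθ
      rcases lt_or_gt_of_ne (hxy m hm θ hθ) with c | c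
      · simp only [c, iff_true]
        have := cy θ hθ
        rw [← this]
        rw [this]
        conv_rhs => rw [← this]
        apply Finset.card_le_card
        intro z
        simp only [Finset.mem_filter]
        rintro ⟨a, b⟩
        exact ⟨a, by omega⟩
      · simp only [not_lt.2 c.le, iff_false, not_le]
        have : Finset.range (θ + 1) ⊆ (Finset.range q).filter (fun θ => y θ < x m) := by
          intro z
          simp only [Finset.mem_filter, Finset.mem_range]
          intro hz
          refine ⟨by omega, ?_⟩
          rcases Nat.lt_or_ge z θ with d | d
          · have := hy _ _ d hθ; omega
          · have : z = θ := by omega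
            subst this; exact c
        have := Finset.card_le_card this
        rw [Finset.card_range] at this
        omega
    rw [key m hm θ hθ]
    rcases lt_or_gt_of_ne (hxy m hm θ hθ) with c | c
    · simp only [c, true_iff]
      have : Finset.range (m + 1) ⊆ (Finset.range p).filter (fun m => x m < y θ) := by
        intro z
        simp only [Finset.mem_filter, Finset.mem_range]
        intro hz
        refine ⟨by omega, ?_⟩
        rcases Nat.lt_or_ge z m with d | d
        · have := hx _ _ d hm; omega
        · have : z = m := by omega
          subst this; exact c
      have := Finset.card_le_card this
      rw [Finset.card_range] at this
      omega
    · simp only [not_lt.2 c.le, false_iff, not_lt]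
      conv_rhs => rw [← cx m hm]
      apply Finset.card_le_card
      intro z
      simp only [Finset.mem_filter]
      rintro ⟨a, b⟩
      exact ⟨a, by omega⟩
  · intro m hm
    exact (Finset.card_filter_le _ _).trans (by simp)
  · intro m hm
    exact (Finset.card_filter_le _ _).trans (by simp)
  · intro m hm
    have := hcount (x m) (hxb m hm).le
    rw [cx m hm] at this
    exact this
  · intro m hm
    have := hcount (y m) (hyb m hm).le
    rw [cy m hm] at this
    simp only
    omega

/-- Conjugate data from rational shuffles. -/
theorem cj_of_rat {p q : ℕ} {zL zR : ℕ → ℚ} (c : ℚ)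
    (hx : ∀ m m', m < m' → m' < p → zL m' < zL m) (hy : ∀ m m', m < m' → m' < q → zR m' < zR m)
    (hxy : ∀ m < p, ∀ θ < q, zL m ≠ zR θ)
    (hxb : ∀ m < p, ∃ x < p + q, zL m = c - (x : ℕ)) (hyb : ∀ θ < q, ∃ x < p + q, zR θ = c - (x : ℕ)) :
    ∃ β α, Cj p q β α ∧ (∀ m < p, zL m = c - m - β m) ∧ (∀ θ < q, zR θ = c - θ - α θ) := by
  choose! x hx1 hx2 using hxb
  choose! y hy1 hy2 using hyb
  have w1 : ∀ m m', m < m' → m' < p → x m < x m' := by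
    intro m m' a b
    have := hx m m' a b
    rw [hx2 m (by omega), hx2 m' b] at this
    exact_mod_cast (by linarith : (x m : ℚ) < x m')
  have w2 : ∀ m m', m < m' → m' < q → y m < y m' := by
    intro m m' a b
    have := hy m m' a b
    rw [hy2 m (by omega), hy2 m' b] at this
    exact_mod_cast (by linarith : (y m : ℚ) < y m')
  have w3 : ∀ m < p, ∀ θ < q, x m ≠ y θ := by
    intro m a θ b e
    apply hxy m a θ b
    rw [hx2 m a, hy2 θ b, e]
  obtain ⟨β, α, h, h1, h2⟩ := cj_of_nat w1 w2 w3 hx1 hy1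
  refine ⟨β, α, h, ?_, ?_⟩
  · intro m hm
    rw [hx2 m hm, h1 m hm]; push_cast; ring
  · intro m hm
    rw [hy2 m hm, h2 m hm]; push_cast; ring

theorem count_ineq {P n t : ℕ} {X Y : ℕ → ℕ} (hX : (Multiset.range P).map X ≤
    (Multiset.range P).map Y + Multiset.replicate n t) (pr : ℕ → Prop) [DecidablePred pr]
    (ht : ¬ pr t) : ((Finset.range P).filter (fun m => pr (X m))).card ≤
      ((Finset.range P).filter (fun m => pr (Y m))).card := by
  have := Multiset.countP_le_of_le pr hX
  rw [Multiset.countP_add, Multiset.countP_map, Multiset.countP_map] at this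
  have h0 : Multiset.countP pr (Multiset.replicate n t) = 0 := by
    rw [Multiset.countP_eq_zero]
    intro a ha
    rw [Multiset.eq_of_mem_replicate ha]; exact ht
  rw [h0] at this
  exact this

theorem core_half {P Q n r t : ℕ} {X X' Y Y' : ℕ → ℕ} (hX : Cj P Q X X') (hY : Cj P Q Y Y')
    (h1 : (Multiset.range P).map X ≤ (Multiset.range P).map Y + Multiset.replicate n t)
    (h2 : (Multiset.range Q).map X' ≤ (Multiset.range Q).map Y' + Multiset.replicate n r)
    (hr : ∀ m < P, m < r → Y m ≤ t) (hr' : ∀ m < P, r ≤ m → t ≤ Y m) :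
    ∀ m < P, X m = Y m := by
  intro m hm
  have c1 : ∀ θ < Q, θ < t → X' θ ≤ Y' θ := by
    intro θ hθ h
    have := count_ineq h1 (fun x => x ≤ θ) (by omega)
    rwa [hX.count_le hθ, hY.count_le hθ] at this
  have c2 : ∀ θ < Q, t ≤ θ → Y' θ ≤ X' θ := by
    intro θ hθ h
    have := count_ineq h1 (fun x => θ < x) (by omega)
    have a := hX.count_gt hθ
    have b := hY.count_gt hθ
    omega
  have d1 : m < r → X m ≤ Y m := by
    intro h
    have := count_ineq h2 (fun x => x ≤ m) (by omega)
    rwa [hX.symm.count_le hm, hY.symm.count_le hm] at this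
  have d2 : r ≤ m → Y m ≤ X m := by
    intro h
    have := count_ineq h2 (fun x => m < x) (by omega)
    have a := hX.symm.count_gt hm
    have b := hY.symm.count_gt hm
    omega
  obtain ⟨x1, x2, x3⟩ := hX
  obtain ⟨y1, y2, y3⟩ := hY
  have e1 := x2 m hm
  have e2 := y2 m hm
  by_cases h : m < r
  · have := d1 h
    by_contra ne
    have := hr m hm h
    have := c1 (X m) (by omega) (by omega)
    have := x1 m hm (X m) (by omega)
    have := y1 m hm (X m) (by omega)
    omega
  · have := d2 (by omega)
    by_contra ne
    have := hr' m hm (by omega)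
    have := c2 (Y m) (by omega) (by omega)
    have := x1 m hm (Y m) (by omega)
    have := y1 m hm (Y m) (by omega)
    omega

theorem count_b (p q : ℕ) (s : ℤ) :
    Nat.card {b : Fin p → ℤ // Antitone b ∧ ∀ m, s ≤ b m ∧ b m ≤ s + q} = (p + q).choose p := by
  have key : Nat.card (Fin p ↪o Fin (p + q)) = (p + q).choose p := by
    rw [Nat.card_congr Set.powersetCard.ofFinEmbEquiv, Set.powersetCard.card, Nat.card_fin]
  rw [← key]
  let F : {b : Fin p → ℤ // Antitone b ∧ ∀ m, s ≤ b m ∧ b m ≤ s + q} → (Fin p ↪o Fin (p + q)) :=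
    fun b => OrderEmbedding.ofStrictMono
      (fun m => (⟨m.1 + (s + q - b.1 m).toNat, by
        have := b.2.2 m
        have := m.2
        omega⟩ : Fin (p + q))) (by
        intro m m' h
        have h1 := b.2.1 h.le
        have := b.2.2 m
        have := b.2.2 m'
        rw [Fin.lt_def] at h ⊢
        simp only
        omega)
  apply Nat.card_eq_of_bijective F
  constructor
  · intro b b' h
    apply Subtype.ext
    funext m
    have : m.1 + (s + q - b.1 m).toNat = m.1 + (s + q - b'.1 m).toNat :=
      congrArg (fun f => (f m).1) h
    have := b.2.2 m
    have := b'.2.2 m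
    omega
  · intro f
    have hgap : ∀ d : ℕ, ∀ m m' : Fin p, m.1 + d = m'.1 → (f m).1 + d ≤ (f m').1 := by
      intro d
      induction d with
      | zero =>
        intro m m' h
        have : m = m' := Fin.ext (by omega)
        subst this; omega
      | succ d ih =>
        intro m m' h
        have hp := m'.2
        have := ih m ⟨m.1 + d, by omega⟩ rfl
        have h2 : f ⟨m.1 + d, by omega⟩ < f m' := by
          rw [f.lt_iff_lt, Fin.lt_def]; simp only; omega
        rw [Fin.lt_def] at h2
        omega
    have hlo : ∀ m : Fin p, m.1 ≤ (f m).1 := by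
      intro m
      have := hgap m.1 ⟨0, by have := m.2; omega⟩ m (by simp)
      omega
    have hhi : ∀ m : Fin p, (f m).1 ≤ m.1 + q := by
      intro m
      have hm := m.2
      have := hgap (p - 1 - m.1) m ⟨p - 1, by omega⟩ (by simp only; omega)
      have := (f ⟨p - 1, by omega⟩).2
      omega
    refine ⟨⟨fun m => s + q - ((f m).1 - m.1 : ℤ), ?_, ?_⟩, ?_⟩
    · intro m m' h
      rw [Fin.le_def] at h
      have := hgap (m'.1 - m.1) m m' (by omega)
      simp only
      omega
    · intro m
      have := hlo m
      have := hhi m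
      simp only
      omega
    · ext m
      change m.1 + (s + q - (s + q - ((f m).1 - m.1 : ℤ))).toNat = (f m).1
      have := hlo m
      have := hhi m
      omega

/-- Conjugate data for the index sets. -/
theorem cj_of_images {r t : ℕ} {i k : ℕ → ℚ} (c : ℚ)
    (hi : ∀ m m', m < m' → m' < r → i m' < i m) (hk : ∀ m m', m < m' → m' < t → k m' < k m)
    (hd : Disjoint ((Finset.range r).image i) ((Finset.range t).image k))
    (hu : (Finset.range r).image i ∪ (Finset.range t).image k =
      (Finset.range (r + t)).image (fun m : ℕ => c + m)) :
    ∃ β α, Cj r t β α ∧ (∀ m < r, i m = c + (r + t) - 1 - m - β m) ∧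
      (∀ θ < t, k θ = c + (r + t) - 1 - θ - α θ) := by
  have conv : ∀ y : ℚ, y ∈ (Finset.range r).image i ∪ (Finset.range t).image k →
      ∃ x < r + t, y = (c + (r + t) - 1) - (x : ℕ) := by
    intro y hy
    rw [hu] at hy
    simp only [Finset.mem_image, Finset.mem_range] at hy
    obtain ⟨x, hx, rfl⟩ := hy
    refine ⟨r + t - 1 - x, by omega, ?_⟩
    have : ((r + t - 1 - x : ℕ) : ℚ) + 1 + x = r + t := by
      exact_mod_cast (by omega : (r + t - 1 - x : ℕ) + 1 + x = r + t)
    linarith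
  apply cj_of_rat (c + (r + t) - 1) hi hk
  · intro m hm θ hθ e
    rw [Finset.disjoint_left] at hd
    exact hd (Finset.mem_image_of_mem i (by simpa using hm))
      (e ▸ Finset.mem_image_of_mem k (by simpa using hθ))
  · intro m hm
    exact conv _ (Finset.mem_union_left _ (Finset.mem_image_of_mem i (by simpa using hm)))
  · intro m hm
    exact conv _ (Finset.mem_union_right _ (Finset.mem_image_of_mem k (by simpa using hm)))

theorem replicate_eq_map {X : Type*} (n : ℕ) (x : X) :
    Multiset.replicate n x = (Multiset.range n).map (fun _ => x) := by
  rw [Multiset.map_const', Multiset.card_range]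

/-- The target multiset. -/
theorem block_map {r s t n : ℕ} {κ lam : ℕ → ℕ} {i j : ℕ → ℚ}
    (hi : ∀ m < r, i m = ((n : ℚ) + 1) / 2 + (r + t) - 1 - m - κ m)
    (hj : ∀ m < s, j m = -((n : ℚ) + 1) / 2 - m - lam m) :
    (Multiset.range (r + n + s)).map (blockVec r n (((n : ℚ) + 1) / 2 + r) i j) =
      ((Multiset.range (r + s)).map (fun m => (ccat r t κ lam m : ℤ)) +
        Multiset.replicate n (t : ℤ)).map
        (fun x : ℤ => ((n : ℚ) + 1) / 2 + r + t - x) := by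
  rw [replicate_eq_map, range_map_add, range_map_add, range_map_add, Multiset.map_add,
    Multiset.map_add, Multiset.map_map, Multiset.map_map, Multiset.map_map, add_right_comm]
  congr 1
  · congr 1
    · apply Multiset.map_congr rfl
      intro m hm
      rw [Multiset.mem_range] at hm
      simp only [blockVec, ccat, hm, if_true, Function.comp, hi m hm]
      push_cast; ring
    · apply Multiset.map_congr rfl
      intro m hm
      rw [Multiset.mem_range] at hm
      simp only [blockVec, ccat, Function.comp]
      rw [if_neg (by omega), if_neg (by omega), if_neg (by omega), Nat.add_sub_cancel_left,
        Nat.add_sub_cancel_left, hj m hm]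
      push_cast; ring
  · apply Multiset.map_congr rfl
    intro m hm
    rw [Multiset.mem_range] at hm
    simp only [blockVec, Function.comp]
    rw [if_neg (by omega), if_pos (by omega)]
    push_cast; ring

/-- Integer form of `v`. -/
def tauL (p2 q2 r s t : ℕ) (β : ℕ → ℕ) (b : Fin p2 → ℤ) (a : Fin q2 → ℤ) : ℕ → ℤ := fun m =>
  if h : m < p2 then β m + b ⟨m, h⟩ + t - s - q2
  else if m < p2 + r + s then β m - q2
  else if h3 : p2 + r + s + q2 - 1 - m < q2 then β m - q2 - a ⟨p2 + r + s + q2 - 1 - m, h3⟩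
  else 0

theorem mu_eq {p2 q2 r s t u : ℕ} {ξ : ℤ} (hξ : 2 * ξ = (r : ℤ) + t - s - u)
    (β : ℕ → ℕ) (b : Fin p2 → ℤ) (a : Fin q2 → ℤ) (m : ℕ) (hm : m < r + s + q2 + p2) (D : ℚ)
    (hD : D = ((r : ℚ) + s + q2 + p2 + (t + u + p2) + q2 - 1) / 2) :
    muLeft (r + s + q2) (t + u + p2) p2 q2 r s ξ b a m + (D - m - β m) =
      ((p2 : ℚ) + q2 + 1) / 2 + r + t - tauL p2 q2 r s t β b a m := by
  have hξ' : (ξ : ℚ) = ((r : ℚ) + t - s - u) / 2 := by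
    have : (2 : ℚ) * ξ = (r : ℚ) + t - s - u := by exact_mod_cast hξ
    linarith
  unfold muLeft tauL
  rw [hD, hξ']
  split_ifs with h1 h2 h3
  · push_cast; ring
  · push_cast; ring
  · push_cast; ring
  · omega

theorem left_iff {p2 q2 r s t u n : ℕ} {ξ : ℤ} (hξ : 2 * ξ = (r : ℤ) + t - s - u)
    {κ lam : ℕ → ℕ} {i j : ℕ → ℚ} (hn : n = p2 + q2)
    (hi : ∀ m < r, i m = ((n : ℚ) + 1) / 2 + (r + t) - 1 - m - κ m)
    (hj : ∀ m < s, j m = -((n : ℚ) + 1) / 2 - m - lam m)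
    (β : ℕ → ℕ) (b : Fin p2 → ℤ) (a : Fin q2 → ℤ) (D : ℚ)
    (hD : D = ((r : ℚ) + s + q2 + p2 + (t + u + p2) + q2 - 1) / 2) :
    (Multiset.map (fun m : Fin (r + s + q2 + p2) =>
      muLeft (r + s + q2) (t + u + p2) p2 q2 r s ξ b a m.1 + (D - (m.1 : ℕ) - β m.1))
        Finset.univ.val =
      Multiset.map (fun m : Fin (r + s + q2 + p2) =>
        blockVec r n (((n : ℚ) + 1) / 2 + r) i j m.1) Finset.univ.val) ↔
    (Multiset.range (p2 + (r + s) + q2)).map (tauL p2 q2 r s t β b a) =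
      (Multiset.range (r + s)).map (fun m => (ccat r t κ lam m : ℤ)) +
        Multiset.replicate n (t : ℤ) := by
  rw [fin_map_range (fun m => muLeft (r + s + q2) (t + u + p2) p2 q2 r s ξ b a m + (D - m - β m)),
    fin_map_range]
  have e1 : (Multiset.range (r + s + q2 + p2)).map
      (fun m => muLeft (r + s + q2) (t + u + p2) p2 q2 r s ξ b a m + (D - m - β m)) =
      ((Multiset.range (p2 + (r + s) + q2)).map (tauL p2 q2 r s t β b a)).map
        (fun x : ℤ => ((n : ℚ) + 1) / 2 + r + t - x) := by
    rw [Multiset.map_map, show p2 + (r + s) + q2 = r + s + q2 + p2 by omega]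
    apply Multiset.map_congr rfl
    intro m hm
    rw [Multiset.mem_range] at hm
    rw [mu_eq hξ β b a m hm D hD, hn]
    simp
  rw [e1, show r + s + q2 + p2 = r + n + s by omega, block_map (t := t) hi hj]
  apply Function.Injective.eq_iff
  apply Multiset.map_injective
  intro x y h
  simpa using h

theorem tau_start {p2 q2 r s t : ℕ} {β : ℕ → ℕ} {b : Fin p2 → ℤ} {a : Fin q2 → ℤ} (m : ℕ)
    (h : m < p2) : tauL p2 q2 r s t β b a m = β m + b ⟨m, h⟩ + t - s - q2 := by
  unfold tauL; rw [dif_pos h]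

theorem tau_mid {p2 q2 r s t : ℕ} {β : ℕ → ℕ} {b : Fin p2 → ℤ} {a : Fin q2 → ℤ} (m : ℕ)
    (h : m < r + s) : tauL p2 q2 r s t β b a (p2 + m) = β (p2 + m) - q2 := by
  unfold tauL; rw [dif_neg (by omega), if_pos (by omega)]

theorem tau_end {p2 q2 r s t : ℕ} {β : ℕ → ℕ} {b : Fin p2 → ℤ} {a : Fin q2 → ℤ} (m : ℕ)
    (h : m < q2) : tauL p2 q2 r s t β b a (p2 + (r + s) + q2 - 1 - m) =
      β (p2 + (r + s) + q2 - 1 - m) - q2 - a ⟨m, h⟩ := by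
  unfold tauL
  rw [dif_neg (by omega), if_neg (by omega), dif_pos (by omega)]
  congr 3
  omega

theorem tau_bounds {P Q n t : ℕ} {p : ℕ} {Y Y' : ℕ → ℕ} {τ : ℕ → ℤ} (hY : Cj P Q Y Y') (ht : t ≤ Q)
    (hL : (Multiset.range p).map τ = (Multiset.range P).map (fun m => (Y m : ℤ)) +
      Multiset.replicate n (t : ℤ)) : ∀ m < p, 0 ≤ τ m ∧ τ m ≤ Q := by
  intro m hm
  have : τ m ∈ (Multiset.range p).map τ := Multiset.mem_map_of_mem _ (by simpa using hm)
  rw [hL, Multiset.mem_add, Multiset.mem_map] at this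
  rcases this with ⟨x, hx, e⟩ | h
  · have := hY.2.1 x (by simpa using hx)
    omega
  · have := Multiset.eq_of_mem_replicate h
    omega

theorem low_bound {p2 q2 r s t : ℕ} {β : ℕ → ℕ} {b : Fin p2 → ℤ} {a : Fin q2 → ℤ}
    (ha : ∀ m, 0 ≤ a m)
    (hb : ∀ m < p2 + (r + s) + q2, 0 ≤ tauL p2 q2 r s t β b a m) :
    ∀ m, p2 ≤ m → m < p2 + (r + s) + q2 → q2 ≤ β m := by
  intro m h1 h2
  have := hb m h2
  unfold tauL at this
  rw [dif_neg (by omega)] at this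
  split_ifs at this with h3 h4
  · omega
  · have := ha ⟨p2 + r + s + q2 - 1 - m, h4⟩
    omega
  · omega

theorem le_of_map_eq {p2 P q2 n : ℕ} {t : ℕ} {τ : ℕ → ℤ} {X Y : ℕ → ℕ}
    (hL : (Multiset.range (p2 + P + q2)).map τ = (Multiset.range P).map (fun m => (Y m : ℤ)) +
      Multiset.replicate n (t : ℤ)) (hX : ∀ m < P, τ (p2 + m) = X m) :
    (Multiset.range P).map X ≤ (Multiset.range P).map Y + Multiset.replicate n t := by
  rw [← Multiset.map_le_map_iff (f := fun x : ℕ => (x : ℤ)) Nat.cast_injective, Multiset.map_add,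
    Multiset.map_map, Multiset.map_map, Multiset.map_replicate]
  change (Multiset.range P).map (fun m => (X m : ℤ)) ≤
    (Multiset.range P).map (fun m => (Y m : ℤ)) + Multiset.replicate n (t : ℤ)
  rw [← hL, range_map_add, range_map_add]
  have : (Multiset.range P).map (fun m => (X m : ℤ)) = (Multiset.range P).map (fun m => τ (p2 + m)) :=
    Multiset.map_congr rfl (fun m hm => (hX m (by simpa using hm)).symm)
  rw [this]
  exact (Multiset.le_add_left _ _).trans (Multiset.le_add_right _ _)

theorem ends_eq {p2 P q2 n : ℕ} {t : ℕ} {τ : ℕ → ℤ} {Y : ℕ → ℕ}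
    (hL : (Multiset.range (p2 + P + q2)).map τ = (Multiset.range P).map (fun m => (Y m : ℤ)) +
      Multiset.replicate n (t : ℤ)) (hX : ∀ m < P, τ (p2 + m) = Y m) :
    (∀ m < p2, τ m = t) ∧ (∀ m < q2, τ (p2 + P + q2 - 1 - m) = t) := by
  rw [range_map_add, range_map_add] at hL
  have : (Multiset.range P).map (fun m => τ (p2 + m)) = (Multiset.range P).map (fun m => (Y m : ℤ)) :=
    Multiset.map_congr rfl (fun m hm => (hX m (by simpa using hm)))
  rw [this, add_comm (Multiset.map τ _), add_assoc] at hL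
  have hL := add_left_cancel hL
  constructor
  · intro m hm
    apply Multiset.eq_of_mem_replicate (n := n)
    rw [← hL, Multiset.mem_add]
    exact Or.inl (Multiset.mem_map_of_mem _ (by simpa using hm))
  · intro m hm
    apply Multiset.eq_of_mem_replicate (n := n)
    rw [← hL, Multiset.mem_add]
    right
    rw [Multiset.mem_map]
    refine ⟨q2 - 1 - m, by simp; omega, ?_⟩
    congr 1
    omega

/-- The converse of `ends_eq`. -/
theorem map_eq_of_ends {p2 P q2 : ℕ} {t : ℕ} {τ : ℕ → ℤ} {Y : ℕ → ℕ}
    (hX : ∀ m < P, τ (p2 + m) = Y m) (h1 : ∀ m < p2, τ m = t)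
    (h2 : ∀ m < q2, τ (p2 + P + q2 - 1 - m) = t) :
    (Multiset.range (p2 + P + q2)).map τ = (Multiset.range P).map (fun m => (Y m : ℤ)) +
      Multiset.replicate (p2 + q2) (t : ℤ) := by
  rw [range_map_add, range_map_add, replicate_eq_map, range_map_add, add_comm (Multiset.map τ _),
    add_assoc]
  congr 1
  · exact Multiset.map_congr rfl (fun m hm => (hX m (by simpa using hm)))
  · congr 1
    · exact Multiset.map_congr rfl (fun m hm => (h1 m (by simpa using hm)))
    · apply Multiset.map_congr rfl
      intro m hm
      rw [Multiset.mem_range] at hm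
      rw [← h2 (q2 - 1 - m) (by omega)]
      congr 1
      omega

theorem forward {p2 q2 r s t u n : ℕ} {β α Y Y' : ℕ → ℕ} {b : Fin p2 → ℤ} {a : Fin q2 → ℤ}
    (h : Cj (p2 + (r + s) + q2) (q2 + (t + u) + p2) β α) (hY : Cj (r + s) (t + u) Y Y')
    (y1 : ∀ m < r + s, m < r → Y m ≤ t) (y2 : ∀ m < r + s, r ≤ m → t ≤ Y m)
    (y3 : ∀ m < t + u, m < t → Y' m ≤ r) (y4 : ∀ m < t + u, t ≤ m → r ≤ Y' m)
    (hb : ∀ m, 0 ≤ b m) (ha : ∀ m, 0 ≤ a m)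
    (hL : (Multiset.range (p2 + (r + s) + q2)).map (tauL p2 q2 r s t β b a) =
      (Multiset.range (r + s)).map (fun m => (Y m : ℤ)) + Multiset.replicate n (t : ℤ))
    (hR : (Multiset.range (q2 + (t + u) + p2)).map (tauL q2 p2 t u r α a b) =
      (Multiset.range (t + u)).map (fun m => (Y' m : ℤ)) + Multiset.replicate n (r : ℤ)) :
    ((∀ m < p2, β m ≤ q2) ∧ (∀ m (hm : m < p2), (β m : ℤ) + b ⟨m, hm⟩ = s + q2) ∧
      (∀ m < r + s, β (p2 + m) = q2 + Y m) ∧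
      (∀ m (hm : m < q2), (β (p2 + (r + s) + q2 - 1 - m) : ℤ) = q2 + t + a ⟨m, hm⟩)) ∧
    ((∀ m < q2, α m ≤ p2) ∧ (∀ m (hm : m < q2), (α m : ℤ) + a ⟨m, hm⟩ = u + p2) ∧
      (∀ m < t + u, α (q2 + m) = p2 + Y' m) ∧
      (∀ m (hm : m < p2), (α (q2 + (t + u) + p2 - 1 - m) : ℤ) = p2 + r + b ⟨m, hm⟩)) := by
  have bL := tau_bounds hY (by omega) hL
  have bR := tau_bounds hY.symm (by omega) hR
  have lL := low_bound ha (fun m hm => (bL m hm).1)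
  have lR := low_bound hb (fun m hm => (bR m hm).1)
  have uL : ∀ m < p2, β m ≤ q2 := by
    intro m hm
    have h2 := h.2.1 m (by omega)
    by_cases c : q2 < q2 + (t + u) + p2
    · have := lR q2 le_rfl c
      exact (h.1 m (by omega) q2 c).2 (by omega)
    · omega
  have uR : ∀ m < q2, α m ≤ p2 := by
    intro m hm
    have h2 := h.2.2 m (by omega)
    by_cases c : p2 < p2 + (r + s) + q2
    · have := lL p2 le_rfl c
      have := h.1 p2 c m (by omega)
      omega
    · omega
  have hX : Cj (r + s) (t + u) (fun m => β (p2 + m) - q2) (fun m => α (q2 + m) - p2) := by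
    refine ⟨fun m hm θ hθ => ?_, fun m hm => ?_, fun m hm => ?_⟩
    · have a1 := lL (p2 + m) (by omega) (by omega)
      have a2 := lR (q2 + θ) (by omega) (by omega)
      have := h.1 (p2 + m) (by omega) (q2 + θ) (by omega)
      simp only
      omega
    · have := (bL (p2 + m) (by omega)).2
      rw [tau_mid m hm] at this
      simp only
      omega
    · have := (bR (q2 + m) (by omega)).2
      rw [tau_mid m hm] at this
      simp only
      omega
  have xL : ∀ m < r + s, tauL p2 q2 r s t β b a (p2 + m) = (β (p2 + m) - q2 : ℕ) := by
    intro m hm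
    have a1 := lL (p2 + m) (by omega) (by omega)
    rw [tau_mid m hm]
    omega
  have xR : ∀ m < t + u, tauL q2 p2 t u r α a b (q2 + m) = (α (q2 + m) - p2 : ℕ) := by
    intro m hm
    have a1 := lR (q2 + m) (by omega) (by omega)
    rw [tau_mid m hm]
    omega
  have iL := le_of_map_eq hL xL
  have iR := le_of_map_eq hR xR
  have eL := core_half hX hY iL iR y1 y2
  have eR := core_half hX.symm hY.symm iR iL y3 y4
  have fL := ends_eq hL (fun m hm => by rw [xL m hm, ← eL m hm])
  have fR := ends_eq hR (fun m hm => by rw [xR m hm, ← eR m hm])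
  refine ⟨⟨uL, ?_, ?_, ?_⟩, ⟨uR, ?_, ?_, ?_⟩⟩
  · intro m hm
    have := fL.1 m hm
    rw [tau_start m hm] at this
    omega
  · intro m hm
    have : β (p2 + m) - q2 = Y m := eL m hm
    have := lL (p2 + m) (by omega) (by omega)
    omega
  · intro m hm
    have := fL.2 m hm
    rw [tau_end m hm] at this
    omega
  · intro m hm
    have := fR.1 m hm
    rw [tau_start m hm] at this
    omega
  · intro m hm
    have : α (q2 + m) - p2 = Y' m := eR m hm
    have := lR (q2 + m) (by omega) (by omega)
    omega
  · intro m hm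
    have := fR.2 m hm
    rw [tau_end m hm] at this
    omega

/-- Existence of the solution attached to an admissible `b`. -/
theorem backward {p2 q2 r s t u : ℕ} {Y Y' : ℕ → ℕ} (hY : Cj (r + s) (t + u) Y Y')
    (b : Fin p2 → ℤ) (hb : Antitone b) (hb2 : ∀ m, (s : ℤ) ≤ b m ∧ b m ≤ s + q2) :
    ∃ (β α : ℕ → ℕ) (a : Fin q2 → ℤ), Cj (p2 + (r + s) + q2) (q2 + (t + u) + p2) β α ∧
      Antitone a ∧ (∀ m, 0 ≤ a m) ∧
      ((Multiset.range (p2 + (r + s) + q2)).map (tauL p2 q2 r s t β b a) =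
      (Multiset.range (r + s)).map (fun m => (Y m : ℤ)) + Multiset.replicate (p2 + q2) (t : ℤ)) ∧
      ((Multiset.range (q2 + (t + u) + p2)).map (tauL q2 p2 t u r α a b) =
      (Multiset.range (t + u)).map (fun m => (Y' m : ℤ)) +
        Multiset.replicate (q2 + p2) (r : ℤ)) := by
  let β1 : ℕ → ℕ := fun m => if h : m < p2 then (s + q2 - b ⟨m, h⟩).toNat else 0
  have hβ1 : ∀ m (h : m < p2), (β1 m : ℤ) = s + q2 - b ⟨m, h⟩ := by
    intro m h
    have := hb2 ⟨m, h⟩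
    simp only [β1, dif_pos h]
    omega
  have hβm : ∀ m m', m ≤ m' → m' < p2 → β1 m ≤ β1 m' := by
    intro m m' h h'
    have a1 := hβ1 m (by omega)
    have a2 := hβ1 m' h'
    have := hb (show (⟨m, by omega⟩ : Fin p2) ≤ ⟨m', h'⟩ from h)
    omega
  let α1 : ℕ → ℕ := fun θ => ((Finset.range p2).filter (fun m => β1 m ≤ θ)).card
  have hc1 : Cj p2 q2 β1 α1 := by
    refine ⟨fun m hm θ hθ => ?_, fun m hm => ?_, fun m hm => ?_⟩
    · constructor
      · intro h
        have : Finset.range (m + 1) ⊆ (Finset.range p2).filter (fun m => β1 m ≤ θ) := by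
          intro z hz
          simp only [Finset.mem_filter, Finset.mem_range] at hz ⊢
          exact ⟨by omega, (hβm z m (by omega) hm).trans h⟩
        have := Finset.card_le_card this
        rw [Finset.card_range] at this
        exact this
      · intro h
        by_contra c
        have : (Finset.range p2).filter (fun m => β1 m ≤ θ) ⊆ Finset.range m := by
          intro z hz
          simp only [Finset.mem_filter, Finset.mem_range] at hz ⊢
          by_contra d
          have := hβm m z (by omega) hz.1
          omega
        have := Finset.card_le_card this
        rw [Finset.card_range] at this
        simp only [α1] at h
        omega
    · have := hβ1 m hm
      have := hb2 ⟨m, hm⟩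
      omega
    · exact (Finset.card_filter_le _ _).trans (by simp)
  have hc3 : Cj q2 p2 (fun m => p2 - α1 (q2 - 1 - m)) (fun m => q2 - β1 (p2 - 1 - m)) := by
    refine ⟨fun m hm θ hθ => ?_, fun m hm => ?_, fun m hm => ?_⟩
    · have := hc1.1 (p2 - 1 - θ) (by omega) (q2 - 1 - m) (by omega)
      have := hc1.2.1 (p2 - 1 - θ) (by omega)
      have := hc1.2.2 (q2 - 1 - m) (by omega)
      simp only
      omega
    · simp only; omega
    · simp only; omega
  refine ⟨_, _, fun m => u + p2 - α1 m.1, (hc1.ccat hY).ccat hc3, ?_, ?_, ?_, ?_⟩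
  · intro m m' h
    have := hc1.symm.mono h m'.2
    simp only
    omega
  · intro m
    have := hc1.2.2 m.1 m.2
    simp only
    omega
  · apply map_eq_of_ends
    · intro m hm
      rw [tau_mid m hm]
      simp only [ccat]
      rw [if_pos (by omega), if_neg (by omega), Nat.add_sub_cancel_left]
      omega
    · intro m hm
      rw [tau_start m hm]
      simp only [ccat]
      rw [if_pos (by omega), if_pos (by omega), hβ1 m hm]
      omega
    · intro m hm
      rw [tau_end m hm]
      simp only [ccat]
      have := hc1.2.2 m hm
      rw [if_neg (by omega),
        show q2 - 1 - (p2 + (r + s) + q2 - 1 - m - (p2 + (r + s))) = m by omega]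
      omega
  · apply map_eq_of_ends
    · intro m hm
      rw [tau_mid m hm]
      simp only [ccat]
      rw [if_pos (by omega), if_neg (by omega), Nat.add_sub_cancel_left]
      omega
    · intro m hm
      rw [tau_start m hm]
      simp only [ccat]
      rw [if_pos (by omega), if_pos (by omega)]
      omega
    · intro m hm
      rw [tau_end m hm]
      simp only [ccat]
      have := hc1.2.1 m hm
      have := hβ1 m hm
      rw [if_neg (by omega),
        show p2 - 1 - (q2 + (t + u) + p2 - 1 - m - (q2 + (t + u))) = m by omega]
      omega

theorem cj_of_fin {p q : ℕ} (zL : Fin p → ℚ) (zR : Fin q → ℚ) (D : ℚ)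
    (hL : StrictAnti zL) (hR : StrictAnti zR)
    (hz : Multiset.map zL Finset.univ.val + Multiset.map zR Finset.univ.val =
      Multiset.map (fun m : ℕ => D - m) (Finset.range (p + q)).val) :
    ∃ β α, Cj p q β α ∧ (∀ m : Fin p, zL m = D - (m.1 : ℕ) - β m.1) ∧
      (∀ m : Fin q, zR m = D - (m.1 : ℕ) - α m.1) := by
  have hnd : (Multiset.map zL Finset.univ.val + Multiset.map zR Finset.univ.val).Nodup := by
    rw [hz]
    apply Multiset.Nodup.map _ (Finset.range (p + q)).nodup
    intro x y h
    simpa using h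
  have hmem : ∀ y : ℚ, y ∈ Multiset.map zL Finset.univ.val + Multiset.map zR Finset.univ.val →
      ∃ x < p + q, y = D - (x : ℕ) := by
    intro y hy
    rw [hz, Multiset.mem_map] at hy
    obtain ⟨x, hx, rfl⟩ := hy
    exact ⟨x, by simpa using hx, rfl⟩
  have hmL : ∀ m, zL m ∈ Multiset.map zL Finset.univ.val :=
    fun m => Multiset.mem_map_of_mem _ (Finset.mem_univ m)
  have hmR : ∀ m, zR m ∈ Multiset.map zR Finset.univ.val :=
    fun m => Multiset.mem_map_of_mem _ (Finset.mem_univ m)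
  obtain ⟨β, α, h, h1, h2⟩ := cj_of_rat (p := p) (q := q)
    (zL := fun m => if h : m < p then zL ⟨m, h⟩ else 0)
    (zR := fun m => if h : m < q then zR ⟨m, h⟩ else 0) D
    (by
      intro m m' a b
      simp only [dif_pos b, dif_pos (a.trans b)]
      exact hL a)
    (by
      intro m m' a b
      simp only [dif_pos b, dif_pos (a.trans b)]
      exact hR a)
    (by
      intro m a θ b e
      simp only [dif_pos a, dif_pos b] at e
      rw [Multiset.nodup_add] at hnd
      exact Multiset.disjoint_left.1 hnd.2.2 (hmL ⟨m, a⟩) (e ▸ hmR ⟨θ, b⟩))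
    (by
      intro m a
      simp only [dif_pos a]
      exact hmem _ (Multiset.mem_add.2 (Or.inl (hmL _))))
    (by
      intro m a
      simp only [dif_pos a]
      exact hmem _ (Multiset.mem_add.2 (Or.inr (hmR _))))
  refine ⟨β, α, h, ?_, ?_⟩
  · intro m
    have := h1 m.1 m.2
    rwa [dif_pos m.2] at this
  · intro m
    have := h2 m.1 m.2
    rwa [dif_pos m.2] at this

/-- The number of solutions `(v, (a,b), z)` of the Dirac cohomology equation for the
unipotent representation `X(p1,q1,ξ)` of `U(p,q)` equals the binomial coefficient
`C(p2+q2, p2)`. -/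
theorem stmt19
    (p1 p2 q1 q2 r s t u : ℕ) (ξ : ℤ) (i j k l : ℕ → ℚ)
    (hp1q2 : q2 ≤ p1) (hq1p2 : p2 ≤ q1)
    (hpar : (p1 + q1) % 2 = (p2 + q2) % 2)
    (hξ1 : (p2 : ℤ) + q2 ≤ (p1 : ℤ) + q1 + 2 * ξ)
    (hξ2 : (p2 : ℤ) + q2 + 2 * ξ ≤ (p1 : ℤ) + q1)
    (hξ3 : (p1 : ℤ) + p2 ≤ (q1 : ℤ) + q2 + 2 * ξ)
    (hξ4 : (q1 : ℤ) + q2 ≤ (p1 : ℤ) + p2 + 2 * ξ)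
    (hrt : 2 * ((r : ℤ) + t) = (p1 : ℤ) + q1 - p2 - q2 + 2 * ξ)
    (hsu : 2 * ((s : ℤ) + u) = (p1 : ℤ) + q1 - p2 - q2 - 2 * ξ)
    (hrs : r + s + q2 = p1) (htu : t + u + p2 = q1)
    (hi_anti : ∀ m m', m < m' → m' < r → i m' < i m)
    (hk_anti : ∀ m m', m < m' → m' < t → k m' < k m)
    (hj_anti : ∀ m m', m < m' → m' < s → j m' < j m)
    (hl_anti : ∀ m m', m < m' → m' < u → l m' < l m)
    (hik_disj : Disjoint ((Finset.range r).image i) ((Finset.range t).image k))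
    (hik_union : (Finset.range r).image i ∪ (Finset.range t).image k =
      (Finset.range (r + t)).image (fun m : ℕ => ((p2 : ℚ) + q2 + 1) / 2 + m))
    (hjl_disj : Disjoint ((Finset.range s).image j) ((Finset.range u).image l))
    (hjl_union : (Finset.range s).image j ∪ (Finset.range u).image l =
      (Finset.range (s + u)).image
        (fun m : ℕ => -((p1 : ℚ) + q1 - 1) / 2 + ξ + m))
    : Nat.card (USol p1 p2 q1 q2 r s t u ξ i j k l) =
      Nat.choose (p2 + q2) p2 := by
  clear hp1q2 hq1p2
  subst hrs htu
  have hξ : 2 * ξ = (r : ℤ) + t - s - u := by push_cast at hrt; omega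
  have hξ' : (2 : ℚ) * ξ = (r : ℚ) + t - s - u := by exact_mod_cast hξ
  have hξR : 2 * ξ = (t : ℤ) + r - u - s := by omega
  obtain ⟨κ, κ', cκ, hi, hk⟩ := cj_of_images _ hi_anti hk_anti hik_disj hik_union
  obtain ⟨lam, lam', cl, hj, hl⟩ := cj_of_images (-(((r + s + q2 : ℕ) : ℚ) +
    ((t + u + p2 : ℕ) : ℚ) - 1) / 2 + ξ) hj_anti hl_anti hjl_disj hjl_union
  have hcast : (p2 : ℚ) + q2 = ((p2 + q2 : ℕ) : ℚ) := by push_cast; rfl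
  have hi' : ∀ m < r, i m = (((p2 + q2 : ℕ) : ℚ) + 1) / 2 + (r + t) - 1 - m - κ m := by
    intro m hm; rw [hi m hm]; push_cast; ring
  have hk' : ∀ m < t, k m = (((p2 + q2 : ℕ) : ℚ) + 1) / 2 + (t + r) - 1 - m - κ' m := by
    intro m hm; rw [hk m hm]; push_cast; ring
  have hj' : ∀ m < s, j m = -(((p2 + q2 : ℕ) : ℚ) + 1) / 2 - m - lam m := by
    intro m hm; rw [hj m hm]; push_cast; linarith
  have hl' : ∀ m < u, l m = -(((p2 + q2 : ℕ) : ℚ) + 1) / 2 - m - lam' m := by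
    intro m hm; rw [hl m hm]; push_cast; linarith
  have hY := cκ.ccat cl
  have y1 : ∀ m < r + s, m < r → ccat r t κ lam m ≤ t := by
    intro m _ hm
    simp only [ccat, if_pos hm]; exact cκ.2.1 m hm
  have y2 : ∀ m < r + s, r ≤ m → t ≤ ccat r t κ lam m := by
    intro m _ hm
    simp only [ccat, if_neg (not_lt.2 hm)]; omega
  have y3 : ∀ m < t + u, m < t → ccat t r κ' lam' m ≤ r := by
    intro m _ hm
    simp only [ccat, if_pos hm]; exact cκ.2.2 m hm
  have y4 : ∀ m < t + u, t ≤ m → r ≤ ccat t r κ' lam' m := by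
    intro m _ hm
    simp only [ccat, if_neg (not_lt.2 hm)]; omega
  obtain ⟨D, hD⟩ : ∃ D : ℚ, D = (((r + s + q2 : ℕ) : ℚ) + p2 + ((t + u + p2 : ℕ) : ℚ) + q2 - 1) / 2 :=
    ⟨_, rfl⟩
  have hDL : D = ((r : ℚ) + s + q2 + p2 + (t + u + p2) + q2 - 1) / 2 := by
    rw [hD]; push_cast; ring
  have hDR : D = ((t : ℚ) + u + p2 + q2 + (r + s + q2) + p2 - 1) / 2 := by
    rw [hD]; push_cast; ring
  have iffL := fun β b a => left_iff (n := p2 + q2) hξ rfl hi' hj' β b a D hDL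
  have iffR := fun β b a => left_iff (n := p2 + q2) hξR (add_comm _ _) hk' hl' β b a D hDR
  have ex : ∀ S : USol (r + s + q2) p2 (t + u + p2) q2 r s t u ξ i j k l, ∃ β α,
      Cj (p2 + (r + s) + q2) (q2 + (t + u) + p2) β α ∧
      (∀ m, S.zL m = D - (m.1 : ℕ) - β m.1) ∧ (∀ m, S.zR m = D - (m.1 : ℕ) - α m.1) ∧
      ((∀ m < p2, β m ≤ q2) ∧ (∀ m (hm : m < p2), (β m : ℤ) + S.b ⟨m, hm⟩ = s + q2) ∧
        (∀ m < r + s, β (p2 + m) = q2 + ccat r t κ lam m) ∧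
        (∀ m (hm : m < q2), (β (p2 + (r + s) + q2 - 1 - m) : ℤ) = q2 + t + S.a ⟨m, hm⟩)) ∧
      ((∀ m < q2, α m ≤ p2) ∧ (∀ m (hm : m < q2), (α m : ℤ) + S.a ⟨m, hm⟩ = u + p2) ∧
        (∀ m < t + u, α (q2 + m) = p2 + ccat t r κ' lam' m) ∧
        (∀ m (hm : m < p2), (α (q2 + (t + u) + p2 - 1 - m) : ℤ) = p2 + r + S.b ⟨m, hm⟩)) := by
    intro S
    have hz := S.hz
    rw [← hD, show r + s + q2 + p2 + (t + u + p2) + q2 = (r + s + q2 + p2) + (t + u + p2 + q2) by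
      omega] at hz
    obtain ⟨β, α, h, h1, h2⟩ := cj_of_fin S.zL S.zR D S.zL_anti S.zR_anti hz
    rw [show r + s + q2 + p2 = p2 + (r + s) + q2 by omega,
      show t + u + p2 + q2 = q2 + (t + u) + p2 by omega] at h
    refine ⟨β, α, h, h1, h2, ?_⟩
    have hL := S.hvL
    have eL : S.vL = fun m => muLeft (r + s + q2) (t + u + p2) p2 q2 r s ξ S.b S.a m.1 +
        (D - (m.1 : ℕ) - β m.1) := by
      funext m; rw [S.heqL m, h1 m]
    rw [eL, hcast, iffL] at hL
    have hR := S.hvR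
    have eR : S.vR = fun m => muLeft (t + u + p2) (r + s + q2) q2 p2 t u ξ S.a S.b m.1 +
        (D - (m.1 : ℕ) - α m.1) := by
      funext m; rw [S.heqR m, h2 m]; rfl
    rw [eR, hcast, iffR] at hR
    exact forward h hY y1 y2 y3 y4 S.b_nonneg S.a_nonneg hL hR
  rw [← count_b p2 q2 s]
  refine Nat.card_eq_of_bijective (fun S => ⟨S.b, S.b_anti, fun m => ?_⟩) ⟨?_, ?_⟩
  · obtain ⟨β, α, -, -, -, ⟨h1, h2, -⟩, -⟩ := ex S
    have := h1 m.1 m.2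
    have := h2 m.1 m.2
    simp only [Fin.eta] at this
    omega
  · intro S S' hS
    have hb : S.b = S'.b := congrArg Subtype.val hS
    obtain ⟨β, α, c, zl, zr, ⟨l1, l2, l3, l4⟩, ⟨r1, r2, r3, r4⟩⟩ := ex S
    obtain ⟨β', α', c', zl', zr', ⟨l1', l2', l3', l4'⟩, ⟨r1', r2', r3', r4'⟩⟩ := ex S'
    have e1 : ∀ m < p2, β m = β' m := by
      intro m hm
      have a1 := l2 m hm
      have a2 := l2' m hm
      rw [hb] at a1
      omega
    have e2 : ∀ m < q2, α m = α' m := by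
      have d : Cj p2 q2 β α :=
        ⟨fun m hm θ hθ => c.1 m (by omega) θ (by omega), l1, r1⟩
      have d' : Cj p2 q2 β' α' :=
        ⟨fun m hm θ hθ => c'.1 m (by omega) θ (by omega), l1', r1'⟩
      exact d.unique d' e1
    have ha : S.a = S'.a := by
      funext m
      have a1 := r2 m.1 m.2
      have a2 := r2' m.1 m.2
      rw [e2 m.1 m.2] at a1
      simp only [Fin.eta] at a1 a2
      omega
    have e3 : ∀ m < p2 + (r + s) + q2, β m = β' m := by
      intro m hm
      by_cases c1 : m < p2
      · exact e1 m c1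
      by_cases c2 : m < p2 + (r + s)
      · have a1 := l3 (m - p2) (by omega)
        have a2 := l3' (m - p2) (by omega)
        rw [show p2 + (m - p2) = m by omega] at a1 a2
        rw [a1, a2]
      · have a1 := l4 (p2 + (r + s) + q2 - 1 - m) (by omega)
        have a2 := l4' (p2 + (r + s) + q2 - 1 - m) (by omega)
        rw [show p2 + (r + s) + q2 - 1 - (p2 + (r + s) + q2 - 1 - m) = m by omega] at a1 a2
        rw [ha] at a1
        omega
    have e4 : ∀ m < q2 + (t + u) + p2, α m = α' m := by
      intro m hm
      by_cases c1 : m < q2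
      · exact e2 m c1
      by_cases c2 : m < q2 + (t + u)
      · have a1 := r3 (m - q2) (by omega)
        have a2 := r3' (m - q2) (by omega)
        rw [show q2 + (m - q2) = m by omega] at a1 a2
        rw [a1, a2]
      · have a1 := r4 (q2 + (t + u) + p2 - 1 - m) (by omega)
        have a2 := r4' (q2 + (t + u) + p2 - 1 - m) (by omega)
        rw [show q2 + (t + u) + p2 - 1 - (q2 + (t + u) + p2 - 1 - m) = m by omega] at a1 a2
        rw [hb] at a1
        omega
    have hzL : S.zL = S'.zL := by
      funext m
      rw [zl, zl', e3 m.1 (by have := m.2; omega)]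
    have hzR : S.zR = S'.zR := by
      funext m
      rw [zr, zr', e4 m.1 (by have := m.2; omega)]
    have hvL : S.vL = S'.vL := by
      funext m
      rw [S.heqL, S'.heqL, hb, ha, hzL]
    have hvR : S.vR = S'.vR := by
      funext m
      rw [S.heqR, S'.heqR, hb, ha, hzR]
    clear ex l1 l2 l3 l4 r1 r2 r3 r4 l1' l2' l3' l4' r1' r2' r3' r4' zl zr zl' zr' hS
    cases S
    cases S'
    simp only at hb ha hzL hzR hvL hvR
    subst hb ha hzL hzR hvL hvR
    rfl
  · rintro ⟨b, hb, hb2⟩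
    obtain ⟨β, α, a, c, ha, ha0, hL, hR⟩ := backward hY b hb hb2
    rw [add_comm q2 p2] at hR
    have sh := congrArg (Multiset.map (fun m : ℕ => D - m)) (shuffle_of_cj c)
    refine ⟨{
      vL := fun m => muLeft (r + s + q2) (t + u + p2) p2 q2 r s ξ b a m.1 +
        (D - (m.1 : ℕ) - β m.1)
      vR := fun m => muLeft (t + u + p2) (r + s + q2) q2 p2 t u ξ a b m.1 +
        (D - (m.1 : ℕ) - α m.1)
      b := b
      a := a
      zL := fun m => D - (m.1 : ℕ) - β m.1
      zR := fun m => D - (m.1 : ℕ) - α m.1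
      b_anti := hb
      b_nonneg := fun m => by have := hb2 m; omega
      a_anti := ha
      a_nonneg := ha0
      hvL := ?_
      hvR := ?_
      zL_anti := ?_
      zR_anti := ?_
      hz := ?_
      heqL := fun m => rfl
      heqR := fun m => rfl }, rfl⟩
    · rw [hcast]
      exact (iffL β b a).2 hL
    · rw [hcast]
      exact (iffR α a b).2 hR
    · intro m m' h
      rw [Fin.lt_def] at h
      have := c.mono h.le (by have := m'.2; omega)
      have h1 : (m.1 : ℚ) < m'.1 := by exact_mod_cast h
      have h2 : (β m.1 : ℚ) ≤ β m'.1 := by exact_mod_cast this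
      simp only
      linarith
    · intro m m' h
      rw [Fin.lt_def] at h
      have := c.symm.mono h.le (by have := m'.2; omega)
      have h1 : (m.1 : ℚ) < m'.1 := by exact_mod_cast h
      have h2 : (α m.1 : ℚ) ≤ α m'.1 := by exact_mod_cast this
      simp only
      linarith
    · rw [fin_map_range (fun m => D - (m : ℚ) - β m), fin_map_range (fun m => D - (m : ℚ) - α m),
        ← hD, show r + s + q2 + p2 + (t + u + p2) + q2 =
          p2 + (r + s) + q2 + (q2 + (t + u) + p2) by omega,
        show r + s + q2 + p2 = p2 + (r + s) + q2 by omega,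
        show t + u + p2 + q2 = q2 + (t + u) + p2 by omega]
      rw [Multiset.map_add, Multiset.map_map, Multiset.map_map] at sh
      rw [← show Multiset.range _ = (Finset.range _).val from rfl, ← sh]
      congr 1
      · apply Multiset.map_congr rfl
        intro m _
        simp only [Function.comp]
        push_cast; ring
      · apply Multiset.map_congr rfl
        intro m _
        simp only [Function.comp]
        push_cast; ring
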